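/- arXiv:2109.00832 — 2 statements merged into one kernel-verified Lean document; each statement's English description precedes it below -/
import Mathlib

section
/- Let X be an infinite-dimensional closed sublattice of C[0,1] that is not lattice isomorphic to c₀. Then there exist a positive norm-one function g_n ∈ X, a positive g ∈ X with g ≥ g_n, and a connected component I = (a,b) of {t : g_n(t) > 0} such that g_n attains the value 1 on I and g(t) ≥ 1/2 for every t in the closure of I. -/
/-- A closed sublattice `X` of `C[0,1]` is lattice isomorphic to `c₀` if there is a
bounded-below continuous linear map from `c₀ = C₀(ℕ, ℝ)` onto `X` turning pointwise
suprema into suprema in `C[0,1]`. -/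
def LatticeIsoToCzero (X : Submodule ℝ C(unitInterval, ℝ)) : Prop :=
  ∃ T : ZeroAtInftyContinuousMap ℕ ℝ →L[ℝ] C(unitInterval, ℝ),
    LinearMap.range (T : ZeroAtInftyContinuousMap ℕ ℝ →ₗ[ℝ] C(unitInterval, ℝ)) = X ∧
    (∃ c : ℝ, 0 < c ∧ ∀ f : ZeroAtInftyContinuousMap ℕ ℝ, c * ‖f‖ ≤ ‖T f‖) ∧
    (∀ f g h : ZeroAtInftyContinuousMap ℕ ℝ,
      (∀ n : ℕ, h n = max (f n) (g n)) → T h = T f ⊔ T g)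

open Set Filter Topology

lemma aux_interval (S : Set unitInterval) (hS : IsOpen S) (hc : S.OrdConnected) (c : unitInterval)
    (hcS : c ∈ S) : ∃ a b : ℝ, a < b ∧ (Subtype.val ⁻¹' Set.Ioo a b : Set unitInterval) = S := by
  have hl : ∃ a : ℝ, a < c ∧ ∀ x : unitInterval, x ≤ c → (x ∈ S ↔ a < x) := by
    by_cases h0 : (0 : unitInterval) ∈ S
    · refine ⟨-1, by linarith [c.2.1], fun x hx => ⟨fun _ => by linarith [x.2.1], fun _ => ?_⟩⟩
      exact hc.out h0 hcS ⟨x.2.1, hx⟩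
    · set i := sInf S with hi
      have hiS : i ∉ S := by
        intro h
        have hpos : 0 < i := by
          rcases eq_or_lt_of_le (show 0 ≤ i from i.2.1) with h' | h'
          · exact absurd (h' ▸ h) h0
          · exact h'
        obtain ⟨l, hl, hl'⟩ := exists_Ioc_subset_of_mem_nhds (hS.mem_nhds h) ⟨0, hpos⟩
        obtain ⟨y, hy1, hy2⟩ := exists_between hl
        have := sInf_le (hl' ⟨hy1, hy2.le⟩)
        exact absurd hy2 (not_lt.2 this)
      have hlt : ∀ x ∈ S, i < x := fun x hx => lt_of_le_of_ne (sInf_le hx) (fun h => hiS (h ▸ hx))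
      refine ⟨i, hlt c hcS, fun x hx => ⟨fun h => hlt x h, fun h => ?_⟩⟩
      obtain ⟨y, hy, hyx⟩ := sInf_lt_iff.1 (show sInf S < x from h)
      exact hc.out hy hcS ⟨hyx.le, hx⟩
  have hr : ∃ b : ℝ, c < b ∧ ∀ x : unitInterval, c ≤ x → (x ∈ S ↔ x < b) := by
    by_cases h0 : (1 : unitInterval) ∈ S
    · refine ⟨2, by linarith [c.2.2], fun x hx => ⟨fun _ => by linarith [x.2.2], fun _ => ?_⟩⟩
      exact hc.out hcS h0 ⟨hx, x.2.2⟩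
    · set i := sSup S with hi
      have hiS : i ∉ S := by
        intro h
        have hpos : i < 1 := by
          rcases eq_or_lt_of_le (show i ≤ 1 from i.2.2) with h' | h'
          · exact absurd (h' ▸ h) h0
          · exact h'
        obtain ⟨l, hl, hl'⟩ := exists_Ico_subset_of_mem_nhds (hS.mem_nhds h) ⟨1, hpos⟩
        obtain ⟨y, hy1, hy2⟩ := exists_between hl
        have := le_sSup (hl' ⟨hy1.le, hy2⟩)
        exact absurd hy1 (not_lt.2 this)
      have hlt : ∀ x ∈ S, x < i := fun x hx => lt_of_le_of_ne (le_sSup hx) (fun h => hiS (h ▸ hx))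
      refine ⟨i, hlt c hcS, fun x hx => ⟨fun h => hlt x h, fun h => ?_⟩⟩
      obtain ⟨y, hy, hyx⟩ := lt_sSup_iff.1 (show x < sSup S from h)
      exact hc.out hcS hy ⟨hx, hyx.le⟩
  obtain ⟨a, ha, ha'⟩ := hl
  obtain ⟨b, hb, hb'⟩ := hr
  refine ⟨a, b, ha.trans hb, ?_⟩
  ext x
  simp only [mem_preimage, mem_Ioo]
  rcases le_total x c with h | h
  · rw [ha' x h]
    exact ⟨fun h => h.1, fun h' => ⟨h', lt_of_le_of_lt h hb⟩⟩
  · rw [hb' x h]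
    exact ⟨fun h => h.2, fun h' => ⟨lt_of_lt_of_le ha h, h'⟩⟩

lemma aux_kill (X : Submodule ℝ C(unitInterval, ℝ))
    (hXlat : ∀ f ∈ X, ∀ g ∈ X, f ⊔ g ∈ X ∧ f ⊓ g ∈ X) (s : unitInterval)
    (v : C(unitInterval, ℝ)) (hv : v ∈ X) (hv0 : 0 ≤ v) (hvs : v s = 1)
    {ι : Type*} (r : ι → unitInterval) (F : Finset ι)
    (hF : ∀ i ∈ F, ∃ w ∈ X, w s = 1 ∧ w (r i) = 0) :
    ∃ v' ∈ X, 0 ≤ v' ∧ v' ≤ v ∧ v' s = 1 ∧ ∀ i ∈ F, v' (r i) = 0 := by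
  classical
  induction F using Finset.induction_on with
  | empty => exact ⟨v, hv, hv0, le_rfl, hvs, by simp⟩
  | insert a F ha ih =>
    obtain ⟨u, huX, hu0, huv, hus, hur⟩ := ih (fun i hi => hF i (Finset.mem_insert_of_mem hi))
    obtain ⟨w, hw, hws, hwr⟩ := hF a (Finset.mem_insert_self _ _)
    have hw' : w ⊔ -w ∈ X := (hXlat w hw _ (X.neg_mem hw)).1
    have hw0 : ∀ t, 0 ≤ (w ⊔ -w) t := fun t => by
      simp only [ContinuousMap.sup_apply, ContinuousMap.neg_apply]
      exact abs_nonneg (w t)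
    refine ⟨u ⊓ (w ⊔ -w), (hXlat u huX _ hw').2, ?_, inf_le_left.trans huv, ?_, ?_⟩
    · intro t
      exact le_inf (hu0 t) (hw0 t)
    · simp [hus, hws]
    · intro i hi
      have h1 : 0 ≤ u (r i) := hu0 (r i)
      rcases Finset.mem_insert.1 hi with rfl | hi
      · simp [hwr, h1]
      · have := hw0 (r i)
        simp only [ContinuousMap.inf_apply, hur i hi]
        exact inf_eq_left.2 this

lemma aux_peak (u : C(unitInterval, ℝ)) (hu : 0 ≤ u) : ∃ c, u c = ‖u‖ := by
  obtain ⟨c, -, hc⟩ := isCompact_univ.exists_isMaxOn (univ_nonempty (α := unitInterval))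
    u.continuous.continuousOn
  refine ⟨c, le_antisymm ((le_abs_self _).trans (u.norm_coe_le_norm c)) ?_⟩
  refine (ContinuousMap.norm_le u (hu c)).2 fun x => ?_
  have hx : 0 ≤ u x := hu x
  rw [Real.norm_eq_abs, abs_of_nonneg hx]
  exact hc (mem_univ x)

lemma aux_grid (S : Set unitInterval) (hc : S.OrdConnected) (K : ℕ) (hK : 0 < K)
    (x y : unitInterval) (hx : x ∈ S) (hy : y ∈ S) (hxy : (x : ℝ) + 1 / K < y) :
    ∃ k : Fin (K + 1), ∃ z ∈ S, (z : ℝ) = (k : ℕ) / K := by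
  have hK' : (0 : ℝ) < K := by exact_mod_cast hK
  have hx0 : (0:ℝ) ≤ x := x.2.1
  set n := ⌈(x : ℝ) * K⌉₊ with hn
  have h1 : (x : ℝ) * K ≤ n := Nat.le_ceil _
  have h2 : (n : ℝ) < x * K + 1 := Nat.ceil_lt_add_one (by positivity)
  have h3 : (x : ℝ) ≤ n / K := by rwa [le_div_iff₀ hK']
  have h4 : (n : ℝ) / K < y := by
    refine lt_of_le_of_lt ?_ hxy
    rw [div_le_iff₀ hK']
    field_simp
    exact h2.le
  have h5 : (n : ℝ) / K < 1 := h4.trans_le y.2.2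
  have h6 : n < K := by
    rw [div_lt_one hK'] at h5
    exact_mod_cast h5
  exact ⟨⟨n, by omega⟩, ⟨(n : ℝ) / K, by positivity, h5.le⟩, hc.out hx hy ⟨h3, h4.le⟩, rfl⟩

lemma aux_bound (X : Submodule ℝ C(unitInterval, ℝ))
    (hXlat : ∀ f ∈ X, ∀ g ∈ X, f ⊔ g ∈ X ∧ f ⊓ g ∈ X)
    (hneg : ∀ gn ∈ X, ∀ g ∈ X, 0 ≤ gn → ‖gn‖ = 1 → gn ≤ g → ∀ c, gn c = 1 →
      ∃ t ∈ closure (connectedComponentIn {t | 0 < gn t} c), g t < 1 / 2)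
    (f : C(unitInterval, ℝ)) (hf : f ∈ X) (ε : ℝ) (hε : 0 < ε) :
    ∃ N : ℕ, ∀ m : Fin N → unitInterval, (∀ i, ε ≤ |f (m i)|) →
      (∀ i j, i ≠ j → ∃ w ∈ X, w (m i) = 1 ∧ w (m j) = 0) → False := by
  classical
  set g : C(unitInterval, ℝ) := ε⁻¹ • (f ⊔ -f) with hg
  have hfabs : f ⊔ -f ∈ X := (hXlat f hf _ (X.neg_mem hf)).1
  have hgX : g ∈ X := X.smul_mem _ hfabs
  have hgt : ∀ t, g t = ε⁻¹ * |f t| := fun t => by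
    simp [hg, abs]
  have huc : UniformContinuous g := CompactSpace.uniformContinuous_of_continuous g.continuous
  obtain ⟨δ, hδ, hδ'⟩ := Metric.uniformContinuous_iff.1 huc (1/2) (by norm_num)
  obtain ⟨K, hK⟩ := exists_nat_one_div_lt hδ
  refine ⟨K + 1 + 2, fun m hm hw => ?_⟩
  have hv : ∀ i, ∃ v ∈ X, 0 ≤ v ∧ v (m i) = 1 ∧ ∀ j, j ≠ i → v (m j) = 0 := by
    intro i
    have hfi : 0 < |f (m i)| := hε.trans_le (hm i)
    obtain ⟨v', h1, h2, -, h3, h4⟩ := aux_kill X hXlat (m i) (|f (m i)|⁻¹ • (f ⊔ -f))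
      (X.smul_mem _ hfabs)
      (by
        intro t
        have : 0 ≤ |f (m i)|⁻¹ * |f t| := by positivity
        simpa [abs] using this)
      (by
        have : |f (m i)|⁻¹ * |f (m i)| = 1 := inv_mul_cancel₀ hfi.ne'
        simpa [abs] using this)
      m (Finset.univ.erase i) (fun j hj => hw i j (Finset.ne_of_mem_erase hj).symm)
    exact ⟨v', h1, h2, h3, fun j hj => h4 j (by simp [hj])⟩
  choose v hvX hv0 hvi hvj using hv
  set u : Fin (K+1+2) → C(unitInterval, ℝ) :=
    fun i => ((v i - ∑ j ∈ Finset.univ.erase i, v j) ⊔ 0) ⊓ g with hu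
  have huX : ∀ i, u i ∈ X := fun i =>
    (hXlat _ (hXlat _ (X.sub_mem (hvX i) (X.sum_mem fun j _ => hvX j)) _ X.zero_mem).1 _ hgX).2
  have hg0 : ∀ t, 0 ≤ g t := fun t => by rw [hgt]; positivity
  have hu0 : ∀ i, 0 ≤ u i := fun i t => le_inf le_sup_right (hg0 t)
  have hug : ∀ i, u i ≤ g := fun i => inf_le_right
  have hui : ∀ i, 1 ≤ u i (m i) := by
    intro i
    have h1 : ∑ j ∈ Finset.univ.erase i, v j (m i) = 0 :=
      Finset.sum_eq_zero fun j hj => hvj j i (Finset.ne_of_mem_erase hj).symm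
    have h2 : 1 ≤ g (m i) := by
      rw [hgt, ← div_eq_inv_mul, le_div_iff₀ hε]; linarith [hm i]
    have h3 : (v i - ∑ j ∈ Finset.univ.erase i, v j) (m i) = 1 := by
      rw [ContinuousMap.sub_apply, ContinuousMap.sum_apply, h1, hvi, sub_zero]
    exact le_inf (h3.ge.trans le_sup_left) h2
  have hdisj : ∀ i j t, 0 < u i t → 0 < u j t → i = j := by
    have key : ∀ i j t, i ≠ j → 0 < u i t → v j t < v i t := by
      intro i j t hij h
      have h1 : 0 < v i t - ∑ j ∈ Finset.univ.erase i, v j t := by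
        simp only [hu, ContinuousMap.inf_apply, ContinuousMap.sup_apply, ContinuousMap.sub_apply,
          ContinuousMap.sum_apply, ContinuousMap.zero_apply] at h
        have := (lt_inf_iff.1 h).1
        rcases lt_sup_iff.1 this with h | h
        · exact h
        · exact absurd h (lt_irrefl _)
      have h2 := Finset.single_le_sum (f := fun j => v j t) (fun j _ => hv0 j t)
        (show j ∈ Finset.univ.erase i by simp [hij.symm])
      linarith
    intro i j t hi hj
    by_contra hij
    exact lt_asymm (key i j t hij hi) (key j i t (Ne.symm hij) hj)
  have hgrid : ∀ i, ∃ k : Fin (K + 1 + 1), ∃ z : unitInterval, 0 < u i z ∧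
      (z : ℝ) = (k : ℕ) / ((K + 1 : ℕ) : ℝ) := by
    intro i
    have hn1 : 1 ≤ ‖u i‖ := (hui i).trans ((le_abs_self _).trans ((u i).norm_coe_le_norm _))
    have hn0 : 0 < ‖u i‖ := by linarith
    obtain ⟨c, hc⟩ := aux_peak (u i) (hu0 i)
    obtain ⟨t, ht, htg⟩ := hneg (‖u i‖⁻¹ • u i) (X.smul_mem _ (huX i)) g hgX
      (fun t => mul_nonneg (by positivity) (hu0 i t))
      (by rw [norm_smul, norm_inv, norm_norm, inv_mul_cancel₀ hn0.ne'])
      (fun t => by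
        refine le_trans ?_ (hug i t)
        exact mul_le_of_le_one_left (hu0 i t) (inv_le_one_of_one_le₀ hn1))
      c (by simp [hc, hn0.ne'])
    have hset : {t | 0 < (‖u i‖⁻¹ • u i) t} = {t | 0 < u i t} := by
      ext t; simp [hn0]
    rw [hset] at ht
    set S := connectedComponentIn {t | 0 < u i t} c with hS
    have hSo : S.OrdConnected := isPreconnected_connectedComponentIn.ordConnected
    have hcS : c ∈ S := mem_connectedComponentIn (by simp [hc]; exact norm_pos_iff.1 hn0)
    have hSsub : S ⊆ {t | 0 < u i t} := connectedComponentIn_subset _ _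
    have hgc : 1 ≤ g c := hn1.trans (hc ▸ hug i c)
    have hdist : δ ≤ dist t c := by
      by_contra h
      have := hδ' (not_le.1 h)
      rw [Real.dist_eq, abs_lt] at this
      linarith [this.1]
    obtain ⟨t', ht'S, ht'⟩ := Metric.mem_closure_iff.1 ht (δ - 1 / ((K:ℝ) + 1)) (by linarith)
    have hd : 1 / ((K : ℝ) + 1) < dist t' c := by
      have := dist_triangle t t' c
      linarith
    rw [Subtype.dist_eq, Real.dist_eq, lt_abs] at hd
    rcases hd with hd | hd
    · obtain ⟨k, z, hz, hzk⟩ := aux_grid S hSo (K+1) (by omega) c t' hcS ht'S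
        (by push_cast; linarith)
      exact ⟨k, z, hSsub hz, hzk⟩
    · obtain ⟨k, z, hz, hzk⟩ := aux_grid S hSo (K+1) (by omega) t' c ht'S hcS
        (by push_cast; linarith)
      exact ⟨k, z, hSsub hz, hzk⟩
  choose k z hz hzk using hgrid
  obtain ⟨i, j, hij, hk⟩ := Fintype.exists_ne_map_eq_of_card_lt k (by simp)
  have : z i = z j := Subtype.ext (by rw [hzk, hzk, hk])
  exact hij (hdisj i j (z i) (hz i) (this ▸ hz j))

lemma aux_iso (X : Submodule ℝ C(unitInterval, ℝ))
    (hXcl : IsClosed (X : Set C(unitInterval, ℝ)))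
    (hXlat : ∀ f ∈ X, ∀ g ∈ X, f ⊔ g ∈ X ∧ f ⊓ g ∈ X)
    (e : ℕ → C(unitInterval, ℝ)) (t : ℕ → unitInterval) (heX : ∀ i, e i ∈ X)
    (het : ∀ i, e i (t i) = 1) (hetj : ∀ i j, i ≠ j → e i (t j) = 0)
    (hrep : ∀ r : unitInterval, (∀ f ∈ X, f r = 0) ∨
      ∃ i, ∃ l : ℝ, |l| ≤ 1 ∧ ∀ f ∈ X, f r = l * f (t i))
    (hfin : ∀ f ∈ X, ∀ ε : ℝ, 0 < ε → {i | ε ≤ |f (t i)|}.Finite) :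
    LatticeIsoToCzero X := by
  have hzero : ∀ f ∈ X, Tendsto (fun i => f (t i)) (cocompact ℕ) (𝓝 0) := by
    intro f hf
    rw [cocompact_eq_cofinite, Metric.tendsto_nhds]
    intro ε hε
    have := hfin f hf ε hε
    simpa [Filter.Eventually, mem_cofinite, compl_ofPred] using this
  let S₀ : X →ₗ[ℝ] ZeroAtInftyContinuousMap ℕ ℝ :=
    { toFun := fun f => ⟨⟨fun i => f.1 (t i), continuous_of_discreteTopology⟩, hzero f.1 f.2⟩
      map_add' := fun f g => by ext i; rfl
      map_smul' := fun c f => by ext i; rfl }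
  have hS₀ : ∀ (f : X) i, S₀ f i = f.1 (t i) := fun f i => rfl
  have hcoe : ∀ (x : ZeroAtInftyContinuousMap ℕ ℝ) i, |x i| ≤ ‖x‖ := fun x i =>
    x.toBCF.norm_coe_le_norm i
  have hle : ∀ (x : ZeroAtInftyContinuousMap ℕ ℝ) (C : ℝ), 0 ≤ C → (∀ i, |x i| ≤ C) → ‖x‖ ≤ C :=
    fun x C hC h => (BoundedContinuousFunction.norm_le (f := x.toBCF) hC).2 h
  have hnorm : ∀ f, ‖S₀ f‖ = ‖f‖ := by
    intro f
    apply le_antisymm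
    · exact hle _ _ (norm_nonneg _) fun i => f.1.norm_coe_le_norm (t i)
    · refine (ContinuousMap.norm_le f.1 (norm_nonneg _)).2 fun r => ?_
      rcases hrep r with h | ⟨i, l, hl, h⟩
      · rw [h _ f.2]; simp
      · rw [h _ f.2, norm_mul]
        calc ‖l‖ * ‖f.1 (t i)‖ ≤ 1 * ‖f.1 (t i)‖ := by gcongr; exact hl
          _ = |S₀ f i| := by rw [one_mul]; rfl
          _ ≤ _ := hcoe _ _
  let S : X →ₗᵢ[ℝ] ZeroAtInftyContinuousMap ℕ ℝ := ⟨S₀, hnorm⟩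
  have : CompleteSpace X := hXcl.completeSpace_coe
  have hclosed : IsClosed (range S) := S.isometry.isClosedEmbedding.isClosed_range
  have hsurj : Function.Surjective S := by
    intro x
    change x ∈ range S
    rw [← hclosed.closure_eq, Metric.mem_closure_iff]
    intro ε hε
    have hx := x.zero_at_infty'
    rw [cocompact_eq_cofinite, Nat.cofinite_eq_atTop, Metric.tendsto_atTop] at hx
    obtain ⟨N, hN⟩ := hx (ε/2) (by linarith)
    let F : X := ⟨∑ i ∈ Finset.range N, x i • e i, X.sum_mem fun i _ => X.smul_mem _ (heX i)⟩
    have hF : ∀ j, S F j = if j < N then x j else 0 := by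
      intro j
      change (∑ i ∈ Finset.range N, x i • e i) (t j) = _
      rw [ContinuousMap.sum_apply]
      have : ∀ i ∈ Finset.range N, (x i • e i) (t j) = if i = j then x j else 0 := by
        intro i _
        split_ifs with h
        · subst h; simp [het]
        · simp [hetj i j h]
      rw [Finset.sum_congr rfl this]
      simp
    refine ⟨S F, ⟨F, rfl⟩, ?_⟩
    rw [dist_eq_norm]
    refine lt_of_le_of_lt (hle _ (ε/2) (by linarith) fun j => ?_) (half_lt_self hε)
    rw [ZeroAtInftyContinuousMap.sub_apply, hF]
    split_ifs with h
    · simp; linarith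
    · have := hN j (not_lt.1 h)
      rw [dist_zero_right] at this
      rw [sub_zero]
      exact this.le
  let E : X ≃ₗᵢ[ℝ] ZeroAtInftyContinuousMap ℕ ℝ := LinearIsometryEquiv.ofSurjective S hsurj
  have hE : ∀ (x : ZeroAtInftyContinuousMap ℕ ℝ) i, (E.symm x).1 (t i) = x i := by
    intro x i
    have : E (E.symm x) i = x i := by rw [E.apply_symm_apply]
    exact this
  refine ⟨X.subtypeL.comp (E.symm.toContinuousLinearEquiv : ZeroAtInftyContinuousMap ℕ ℝ →L[ℝ] X),
    ?_, ⟨1, one_pos, fun f => ?_⟩, fun f g h hh => ?_⟩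
  · ext y
    constructor
    · rintro ⟨x, rfl⟩
      exact (E.symm x).2
    · intro hy
      refine ⟨E ⟨y, hy⟩, ?_⟩
      change (E.symm (E ⟨y, hy⟩)).1 = y
      rw [E.symm_apply_apply]
  · rw [one_mul]
    exact (E.symm.norm_map f).ge
  · change (E.symm h).1 = (E.symm f).1 ⊔ (E.symm g).1
    let w : X := ⟨(E.symm f).1 ⊔ (E.symm g).1, (hXlat _ (E.symm f).2 _ (E.symm g).2).1⟩
    have : E.symm h = w := by
      rw [LinearIsometryEquiv.symm_apply_eq]
      ext i
      rw [hh]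
      change _ = ((E.symm f).1 ⊔ (E.symm g).1) (t i)
      rw [ContinuousMap.sup_apply, hE, hE]
    rw [this]

lemma aux_iso' (X : Submodule ℝ C(unitInterval, ℝ))
    (hXcl : IsClosed (X : Set C(unitInterval, ℝ)))
    (hXlat : ∀ f ∈ X, ∀ g ∈ X, f ⊔ g ∈ X ∧ f ⊓ g ∈ X)
    (hXinf : ¬ FiniteDimensional ℝ X) {ι : Type}
    (e : ι → C(unitInterval, ℝ)) (t : ι → unitInterval) (heX : ∀ i, e i ∈ X)
    (het : ∀ i, e i (t i) = 1) (hetj : ∀ i j, i ≠ j → e i (t j) = 0)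
    (hrep : ∀ r : unitInterval, (∀ f ∈ X, f r = 0) ∨
      ∃ i, ∃ l : ℝ, |l| ≤ 1 ∧ ∀ f ∈ X, f r = l * f (t i))
    (hfin : ∀ f ∈ X, ∀ ε : ℝ, 0 < ε → {i | ε ≤ |f (t i)|}.Finite) :
    LatticeIsoToCzero X := by
  have hinf : Infinite ι := by
    by_contra hni
    rw [not_infinite_iff_finite] at hni
    apply hXinf
    let L : X →ₗ[ℝ] (ι → ℝ) :=
      { toFun := fun f i => f.1 (t i)
        map_add' := fun f g => rfl
        map_smul' := fun c f => rfl }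
    refine FiniteDimensional.of_injective L ?_
    rw [injective_iff_map_eq_zero]
    intro f hf
    ext r
    rcases hrep r with h | ⟨i, l, hl, h⟩
    · exact h _ f.2
    · have h1 : f.1 (t i) = 0 := congrFun hf i
      rw [h _ f.2, h1, mul_zero]; rfl
  have hcnt : Countable ι := by
    have : (univ : Set ι).Countable := by
      refine Set.PairwiseDisjoint.countable_of_isOpen (s := fun i => {r | e i r ≠ 0}) ?_ ?_ ?_
      · intro i _ j _ hij
        refine Set.disjoint_left.2 fun r hi hj => hij ?_
        rcases hrep r with h | ⟨k, l, hl, h⟩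
        · exact absurd (h _ (heX i)) hi
        · have h1 : i = k := by
            by_contra hne
            exact hi (by rw [h _ (heX i), hetj i k hne, mul_zero])
          have h2 : j = k := by
            by_contra hne
            exact hj (by rw [h _ (heX j), hetj j k hne, mul_zero])
          rw [h1, h2]
      · intro i _
        exact isOpen_ne_fun (e i).continuous continuous_const
      · intro i _
        exact ⟨t i, by simp [het]⟩
    exact countable_univ_iff.1 this
  obtain ⟨d⟩ := nonempty_denumerable ι
  let σ : ι ≃ ℕ := Denumerable.eqv ι
  refine aux_iso X hXcl hXlat (fun n => e (σ.symm n)) (fun n => t (σ.symm n))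
    (fun n => heX _) (fun n => het _) (fun i j hij => hetj _ _ (σ.symm.injective.ne hij)) ?_ ?_
  · intro r
    rcases hrep r with h | ⟨k, l, hl, h⟩
    · exact Or.inl h
    · exact Or.inr ⟨σ k, l, hl, fun f hf => by simpa using h f hf⟩
  · intro f hf ε hε
    exact (hfin f hf ε hε).preimage (f := σ.symm) σ.symm.injective.injOn

lemma aux_main (X : Submodule ℝ C(unitInterval, ℝ))
    (hXcl : IsClosed (X : Set C(unitInterval, ℝ)))
    (hXlat : ∀ f ∈ X, ∀ g ∈ X, f ⊔ g ∈ X ∧ f ⊓ g ∈ X)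
    (hXinf : ¬ FiniteDimensional ℝ X)
    (hbd : ∀ f ∈ X, ∀ ε : ℝ, 0 < ε →
      ∃ N : ℕ, ∀ m : Fin N → unitInterval, (∀ i, ε ≤ |f (m i)|) →
      (∀ i j, i ≠ j → ∃ w ∈ X, w (m i) = 1 ∧ w (m j) = 0) → False) :
    LatticeIsoToCzero X := by
  classical
  let U := {r : unitInterval // ∃ f ∈ X, f r ≠ 0}
  let st : Setoid U :=
    { r := fun r s => ∃ l : ℝ, l ≠ 0 ∧ ∀ f ∈ X, f r.1 = l * f s.1
      iseqv := ⟨fun r => ⟨1, one_ne_zero, fun f _ => (one_mul _).symm⟩,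
        fun {r s} ⟨l, hl, h⟩ => ⟨l⁻¹, inv_ne_zero hl, fun f hf => by
          rw [h f hf, inv_mul_cancel_left₀ hl]⟩,
        fun {r s q} ⟨l, hl, h⟩ ⟨k, hk, h'⟩ => ⟨l * k, mul_ne_zero hl hk, fun f hf => by
          rw [h f hf, h' f hf, mul_assoc]⟩⟩ }
  let mk : U → Quotient st := Quotient.mk st
  have hmk : ∀ r s, mk r = mk s → ∃ l : ℝ, l ≠ 0 ∧ ∀ f ∈ X, f r.1 = l * f s.1 :=
    fun r s h => Quotient.exact h
  have hsep : ∀ r s : U, mk r ≠ mk s → ∃ w ∈ X, w r.1 = 1 ∧ w s.1 = 0 := by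
    intro r s hrs
    by_contra hcon
    have h0 : ∀ w ∈ X, w s.1 = 0 → w r.1 = 0 := by
      intro w hw hws
      by_contra hwr
      exact hcon ⟨(w r.1)⁻¹ • w, X.smul_mem _ hw, by simp [hwr], by simp [hws]⟩
    obtain ⟨h, hh, hhs⟩ := s.2
    have key : ∀ f ∈ X, f r.1 = (h r.1 / h s.1) * f s.1 := by
      intro f hf
      have := h0 (f - (f s.1 / h s.1) • h) (X.sub_mem hf (X.smul_mem _ hh)) (by simp [hhs])
      simp only [ContinuousMap.sub_apply, ContinuousMap.smul_apply, smul_eq_mul] at this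
      rw [sub_eq_zero.1 this]; ring
    refine hrs (Quotient.sound ⟨h r.1 / h s.1, ?_, key⟩)
    intro hz
    obtain ⟨f, hf, hfr⟩ := r.2
    exact hfr (by rw [key f hf, hz, zero_mul])
  have hfinite : ∀ f ∈ X, ∀ ε : ℝ, 0 < ε → {q | ∃ r : U, mk r = q ∧ ε ≤ |f r.1|}.Finite := by
    intro f hf ε hε
    by_contra hinf
    obtain ⟨N, hN⟩ := hbd f hf ε hε
    have : Infinite {q | ∃ r : U, mk r = q ∧ ε ≤ |f r.1|} := Set.infinite_coe_iff.2 hinf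
    let emb := Infinite.natEmbedding {q | ∃ r : U, mk r = q ∧ ε ≤ |f r.1|}
    choose r hr hr' using fun n : ℕ => (emb n).2
    refine hN (fun i => (r i).1) (fun i => hr' i) (fun i j hij => hsep _ _ ?_)
    rw [hr, hr]
    intro h
    exact hij (Fin.ext (emb.injective (Subtype.ext h)))
  have hatom : ∀ s : U, ∃ e ∈ X, 0 ≤ e ∧ e s.1 = 1 ∧ ∀ r : U, mk r ≠ mk s → e r.1 = 0 := by
    intro s
    have happ : ∀ n : ℕ, ∃ v ∈ X, 0 ≤ v ∧ v s.1 = 1 ∧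
        ∀ r : U, mk r ≠ mk s → v r.1 ≤ 1 / ((n : ℝ) + 1) := by
      intro n
      obtain ⟨f, hf, hfs⟩ := s.2
      have hfabs : f ⊔ -f ∈ X := (hXlat f hf _ (X.neg_mem hf)).1
      have hfp : 0 < |f s.1| := abs_pos.2 hfs
      set v₀ : C(unitInterval, ℝ) := |f s.1|⁻¹ • (f ⊔ -f) with hv₀
      have hv₀X : v₀ ∈ X := X.smul_mem _ hfabs
      have hv₀t : ∀ t, v₀ t = |f s.1|⁻¹ * |f t| := fun t => by simp [hv₀, abs]
      have hF := hfinite v₀ hv₀X (1 / ((n : ℝ) + 1)) (by positivity)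
      obtain ⟨v, h1, h2, h3, h4, h5⟩ := aux_kill X hXlat s.1 v₀ hv₀X
        (fun t => by
          change 0 ≤ v₀ t
          rw [hv₀t]; positivity)
        (by rw [hv₀t, inv_mul_cancel₀ hfp.ne'])
        (fun q : Quotient st => q.out.1) (hF.toFinset.erase (mk s))
        (fun q hq => hsep s q.out (by
          have h : mk q.out = q := Quotient.out_eq q
          rw [h]
          exact (Finset.ne_of_mem_erase hq).symm))
      refine ⟨v, h1, h2, h4, fun r hr => ?_⟩
      by_cases hbig : 1 / ((n : ℝ) + 1) ≤ |v₀ r.1|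
      · have h6 := h5 (mk r) (by
          rw [Finset.mem_erase, Set.Finite.mem_toFinset]
          exact ⟨hr, r, rfl, hbig⟩)
        obtain ⟨l, hl, h⟩ := hmk r (mk r).out (Quotient.out_eq (mk r)).symm
        rw [h v h1, h6, mul_zero]
        positivity
      · exact (h3 r.1).trans ((le_abs_self _).trans (not_le.1 hbig).le)
    choose v hvX hv0 hvs hvr using happ
    have hcl : ∀ r : unitInterval, (∃ l : ℝ, ∀ f ∈ X, f r = l * f s.1) ∨
        ∃ h : ∃ f ∈ X, f r ≠ 0, mk ⟨r, h⟩ ≠ mk s := by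
      intro r
      by_cases h : ∃ f ∈ X, f r ≠ 0
      · by_cases h' : mk ⟨r, h⟩ = mk s
        · obtain ⟨l, -, hl⟩ := hmk _ _ h'
          exact Or.inl ⟨l, hl⟩
        · exact Or.inr ⟨h, h'⟩
      · push Not at h
        exact Or.inl ⟨0, fun f hf => by rw [h f hf, zero_mul]⟩
    have hd : ∀ N n m : ℕ, N ≤ n → N ≤ m → dist (v n) (v m) ≤ 1 / ((N : ℝ) + 1) := by
      intro N n m hn hm
      rw [ContinuousMap.dist_le (by positivity)]
      intro r
      rcases hcl r with ⟨l, hl⟩ | ⟨h, hr⟩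
      · rw [hl _ (hvX n), hl _ (hvX m), hvs, hvs, dist_self]; positivity
      · have a1 := hvr n ⟨r, h⟩ hr
        have a2 := hvr m ⟨r, h⟩ hr
        have a3 : 0 ≤ v n r := hv0 n r
        have a4 : 0 ≤ v m r := hv0 m r
        have b1 : 1 / ((n : ℝ) + 1) ≤ 1 / ((N : ℝ) + 1) := Nat.one_div_le_one_div hn
        have b2 : 1 / ((m : ℝ) + 1) ≤ 1 / ((N : ℝ) + 1) := Nat.one_div_le_one_div hm
        simp only at a1 a2
        rw [Real.dist_eq, abs_le]
        constructor <;> linarith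
    have hcau : CauchySeq v :=
      cauchySeq_of_le_tendsto_0 (fun N : ℕ => 1 / ((N : ℝ) + 1)) (fun n m N h1 h2 => hd N n m h1 h2)
        tendsto_one_div_add_atTop_nhds_zero_nat
    obtain ⟨e, he⟩ := cauchySeq_tendsto_of_complete hcau
    have hpt : ∀ r, Tendsto (fun n => v n r) atTop (𝓝 (e r)) := fun r =>
      ((continuous_eval_const (F := C(unitInterval, ℝ)) r).tendsto e).comp he
    refine ⟨e, hXcl.mem_of_tendsto he (Eventually.of_forall hvX), ?_, ?_, ?_⟩
    · intro r
      exact ge_of_tendsto' (hpt r) fun n => hv0 n r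
    · refine tendsto_nhds_unique (hpt s.1) ?_
      simp only [hvs]
      exact tendsto_const_nhds
    · intro r hr
      refine tendsto_nhds_unique (hpt r.1) ?_
      exact squeeze_zero (fun n => hv0 n r.1) (fun n => hvr n r hr)
        tendsto_one_div_add_atTop_nhds_zero_nat
  have hpeak : ∀ q : Quotient st, ∃ e ∈ X, ∃ t : U, mk t = q ∧ e t.1 = 1 ∧ (∀ r, |e r| ≤ 1) ∧
      ∀ r : U, mk r ≠ q → e r.1 = 0 := by
    intro q
    obtain ⟨e, heX, he0, hes, her⟩ := hatom q.out
    have hq : mk q.out = q := Quotient.out_eq q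
    rw [hq] at her
    obtain ⟨c, hc⟩ := aux_peak e he0
    have hn : 0 < ‖e‖ := by
      rw [norm_pos_iff]
      rintro rfl
      simp at hes
    have hcU : ∃ f ∈ X, f c ≠ 0 := ⟨e, heX, by rw [hc]; exact hn.ne'⟩
    refine ⟨‖e‖⁻¹ • e, X.smul_mem _ heX, ⟨c, hcU⟩, ?_, ?_, ?_, ?_⟩
    · by_contra hne
      have := her _ hne
      exact hn.ne' (hc.symm.trans this)
    · simp [hc, hn.ne']
    · intro r
      have h1 : |e r| ≤ ‖e‖ := e.norm_coe_le_norm r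
      rw [ContinuousMap.smul_apply, smul_eq_mul, abs_mul, abs_of_pos (inv_pos.2 hn),
        ← div_eq_inv_mul]
      exact (div_le_one hn).2 h1
    · intro r hr
      simp [her r hr]
  choose e heX t ht het hele her using hpeak
  refine aux_iso' X hXcl hXlat hXinf e (fun q => (t q).1) heX het
    (fun i j hij => her i (t j) (by rw [ht]; exact hij.symm)) ?_ ?_
  · intro r
    by_cases h : ∃ f ∈ X, f r ≠ 0
    · right
      obtain ⟨l, -, hl⟩ := hmk ⟨r, h⟩ (t (mk ⟨r, h⟩)) (ht _).symm
      refine ⟨mk ⟨r, h⟩, l, ?_, hl⟩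
      have h1 := hl _ (heX (mk ⟨r, h⟩))
      rw [het, mul_one] at h1
      rw [← h1]
      exact hele _ _
    · push Not at h
      exact Or.inl h
  · intro f hf ε hε
    exact (hfinite f hf ε hε).subset fun q hq => ⟨t q, ht q, hq⟩

/-- If `X` is an infinite-dimensional closed sublattice of `C[0,1]` not lattice
isomorphic to `c₀`, then there are `0 ≤ g_n ≤ g` in `X` with `‖g_n‖ = 1` and a
connected component `I = (a,b)` of `{t : g_n t > 0}` on which `g_n` attains the value
`1`, such that `g ≥ 1/2` on the closure of `I`. -/
theorem exists_good_component
    (X : Submodule ℝ C(unitInterval, ℝ))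
    (hXcl : IsClosed (X : Set C(unitInterval, ℝ)))
    (hXlat : ∀ f ∈ X, ∀ g ∈ X, f ⊔ g ∈ X ∧ f ⊓ g ∈ X)
    (hXinf : ¬ FiniteDimensional ℝ X)
    (hXc₀ : ¬ LatticeIsoToCzero X) :
    ∃ gn g : C(unitInterval, ℝ), gn ∈ X ∧ g ∈ X ∧ 0 ≤ gn ∧ ‖gn‖ = 1 ∧ gn ≤ g ∧
      ∃ a b : ℝ, a < b ∧
        (∃ t₀ ∈ {t : unitInterval | 0 < gn t},
          (Subtype.val ⁻¹' Set.Ioo a b : Set unitInterval) =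
            connectedComponentIn {t : unitInterval | 0 < gn t} t₀) ∧
        (∃ c ∈ (Subtype.val ⁻¹' Set.Ioo a b : Set unitInterval), gn c = 1) ∧
        (∀ t ∈ closure (Subtype.val ⁻¹' Set.Ioo a b : Set unitInterval),
          (1 : ℝ) / 2 ≤ g t) := by
  by_contra hcon
  apply hXc₀
  refine aux_main X hXcl hXlat hXinf (aux_bound X hXlat ?_)
  intro gn hgn g hg h0 h1 hle c hc
  by_contra hno
  push Not at hno
  have : LocallyPathConnectedSpace unitInterval :=
    (convex_Icc (0:ℝ) 1).locallyPathConnectedSpace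
  have hcm : c ∈ {t : unitInterval | 0 < gn t} := by simp [hc]
  have hopen : IsOpen {t : unitInterval | 0 < gn t} :=
    isOpen_lt continuous_const gn.continuous
  obtain ⟨a, b, hab, hS⟩ := aux_interval (connectedComponentIn {t : unitInterval | 0 < gn t} c)
    hopen.connectedComponentIn isPreconnected_connectedComponentIn.ordConnected c
    (mem_connectedComponentIn hcm)
  refine hcon ⟨gn, g, hgn, hg, h0, h1, hle, a, b, hab, ⟨c, hcm, hS⟩, ⟨c, ?_, hc⟩, ?_⟩
  · rw [hS]; exact mem_connectedComponentIn hcm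
  · rw [hS]; exact hno
end

section
/- Every infinite-dimensional closed sublattice of C[0,1] is either lattice isomorphic to c₀ or contains a closed sublattice lattice isomorphic to C[0,1]. -/
namespace SubDich

abbrev I := unitInterval

noncomputable def clip (f g : C(I, ℝ)) (t : I) : I :=
  Set.projIcc (0:ℝ) 1 zero_le_one (g t / f t)

noncomputable def Tfun (f g h : C(I, ℝ)) : C(I, ℝ) where
  toFun t := f t * h (clip f g t)
  continuous_toFun := by
    rw [continuous_iff_continuousAt]
    intro t
    by_cases ht : f t = 0
    · unfold ContinuousAt
      beta_reduce
      rw [ht, zero_mul]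
      have h0 : Filter.Tendsto (fun s => ‖f s‖ * ‖h‖) (nhds t) (nhds 0) := by
        have : Continuous (fun s => ‖f s‖ * ‖h‖) := by fun_prop
        have h1 := this.tendsto t
        simpa [ht] using h1
      refine squeeze_zero_norm (fun s => ?_) h0
      rw [norm_mul]
      exact mul_le_mul_of_nonneg_left (h.norm_coe_le_norm _) (norm_nonneg _)
    · have h1 : ContinuousAt (fun s => g s / f s) t :=
        g.continuous.continuousAt.div f.continuous.continuousAt ht
      have h2 : ContinuousAt (fun s => clip f g s) t :=
        (continuous_projIcc.continuousAt).comp h1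
      exact f.continuous.continuousAt.mul (h.continuous.continuousAt.comp h2)

@[simp] lemma Tfun_apply (f g h : C(I, ℝ)) (t : I) : Tfun f g h t = f t * h (clip f g t) := rfl

noncomputable def TL (f g : C(I, ℝ)) : C(I, ℝ) →L[ℝ] C(I, ℝ) :=
  LinearMap.mkContinuous
    { toFun := Tfun f g
      map_add' := fun a b => by ext t; simp [mul_add]
      map_smul' := fun c b => by ext t; simp; ring } ‖f‖ (by
      intro h
      rw [ContinuousMap.norm_le _ (by positivity)]
      intro t
      simp only [LinearMap.coe_mk, AddHom.coe_mk, Tfun_apply, norm_mul]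
      exact mul_le_mul (f.norm_coe_le_norm _) (h.norm_coe_le_norm _) (norm_nonneg _) (norm_nonneg _))

@[simp] lemma TL_apply (f g h : C(I, ℝ)) (t : I) : TL f g h t = f t * h (clip f g t) := rfl

lemma TL_sup (f g : C(I, ℝ)) (hf : 0 ≤ f) (a b : C(I, ℝ)) :
    TL f g (a ⊔ b) = TL f g a ⊔ TL f g b := by
  ext t
  have : 0 ≤ f t := hf t
  simp [mul_max_of_nonneg _ _ this]

lemma TL_inf (f g : C(I, ℝ)) (hf : 0 ≤ f) (a b : C(I, ℝ)) :
    TL f g (a ⊓ b) = TL f g a ⊓ TL f g b := by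
  ext t
  have : 0 ≤ f t := hf t
  simp [mul_min_of_nonneg _ _ this]

lemma TL_mem (X : Submodule ℝ C(I, ℝ)) (hXcl : IsClosed (X : Set C(I, ℝ)))
    (hXlat : ∀ f ∈ X, ∀ g ∈ X, f ⊔ g ∈ X ∧ f ⊓ g ∈ X)
    (f g : C(I, ℝ)) (hf : 0 ≤ f) (hfX : f ∈ X) (hgX : g ∈ X) (h : C(I, ℝ)) : TL f g h ∈ X := by
  let L : Set C(I, ℝ) := {h | TL f g h ∈ X}
  have hLc : IsClosed L := hXcl.preimage (TL f g).continuous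
  have h1 : TL f g 1 ∈ X := by
    convert hfX
    ext t; simp
  let ι : C(I, ℝ) := ⟨fun t => (t : ℝ), by fun_prop⟩
  have h2 : TL f g ι ∈ X := by
    have : TL f g ι = (g ⊔ 0) ⊓ f := by
      ext t
      have ht : 0 ≤ f t := hf t
      simp only [TL_apply, ι, ContinuousMap.coe_mk, clip, Set.coe_projIcc, ContinuousMap.inf_apply,
        ContinuousMap.sup_apply, ContinuousMap.zero_apply]
      rcases ht.eq_or_lt with h0 | h0
      · simp [← h0]
      · rw [mul_max_of_nonneg _ _ ht, mul_min_of_nonneg _ _ ht, mul_div_cancel₀ _ h0.ne', mul_zero,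
          mul_one]
        rcases le_total (g t) 0 with h3 | h3
        · rw [min_eq_right (h3.trans ht), max_eq_left h3, max_eq_right h3, min_eq_left ht]
        · rw [max_eq_left h3, max_eq_right (le_min ht h3), min_comm]
    rw [this]
    exact (hXlat _ (hXlat _ hgX _ X.zero_mem).1 _ hfX).2
  have hs : L.SeparatesPointsStrongly := by
    intro v x y
    by_cases hxy : x = y
    · subst hxy
      refine ⟨v x • 1, ?_, by simp, by simp⟩
      change TL f g _ ∈ X
      rw [map_smul]; exact X.smul_mem _ h1
    · have hne : (y : ℝ) - x ≠ 0 := fun h => hxy (Subtype.ext (by linarith))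
      refine ⟨v x • 1 + ((v y - v x) / (y - x)) • (ι - (x : ℝ) • 1), ?_, ?_, ?_⟩
      · change TL f g _ ∈ X
        rw [map_add, map_smul, map_smul, map_sub, map_smul]
        exact X.add_mem (X.smul_mem _ h1) (X.smul_mem _ (X.sub_mem h2 (X.smul_mem _ h1)))
      · simp [ι]
      · simp [ι]; field_simp; ring
  have := ContinuousMap.sublattice_closure_eq_top L ⟨1, h1⟩
    (fun a ha b hb => by
      change TL f g _ ∈ X
      rw [TL_inf f g hf]; exact (hXlat _ ha _ hb).2)
    (fun a ha b hb => by
      change TL f g _ ∈ X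
      rw [TL_sup f g hf]; exact (hXlat _ ha _ hb).1) hs
  rw [hLc.closure_eq] at this
  have h3 : h ∈ L := by rw [this]; trivial
  exact h3

lemma TL_below (f g : C(I, ℝ)) (t₁ t₂ : I) (hpos : ∀ s ∈ Set.uIcc t₁ t₂, 0 < f s)
    (h1 : g t₁ = 0) (h2 : g t₂ = f t₂) :
    ∃ c : ℝ, 0 < c ∧ ∀ h : C(I, ℝ), c * ‖h‖ ≤ ‖TL f g h‖ := by
  obtain ⟨s₀, hs₀, hmin⟩ := (isCompact_uIcc (a := t₁) (b := t₂)).exists_isMinOn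
    Set.nonempty_uIcc f.continuous.continuousOn
  refine ⟨f s₀, hpos _ hs₀, fun h => ?_⟩
  have hc := hpos _ hs₀
  suffices ‖h‖ ≤ ‖TL f g h‖ / f s₀ by
    rw [le_div_iff₀ hc] at this; linarith
  rw [ContinuousMap.norm_le _ (by positivity)]
  intro r
  have hco : ContinuousOn (fun s => g s / f s) (Set.uIcc t₁ t₂) :=
    g.continuous.continuousOn.div f.continuous.continuousOn (fun s hs => (hpos s hs).ne')
  have him := (isPreconnected_uIcc (a := t₁) (b := t₂)).intermediate_value
    Set.left_mem_uIcc Set.right_mem_uIcc hco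
  have hr : (r : ℝ) ∈ Set.Icc (g t₁ / f t₁) (g t₂ / f t₂) := by
    rw [h1, h2, div_self (hpos _ Set.right_mem_uIcc).ne', zero_div]
    exact r.2
  obtain ⟨s, hs, hsr⟩ := him hr
  simp only at hsr
  have hcl : clip f g s = r := by
    unfold clip; rw [hsr]; exact Set.projIcc_val _ _
  have h3 := (TL f g h).norm_coe_le_norm s
  rw [TL_apply, hcl, norm_mul] at h3
  rw [le_div_iff₀ hc]
  have h4 : f s₀ ≤ ‖f s‖ := (hmin hs).trans (le_abs_self _)
  nlinarith [norm_nonneg (h r)]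

lemma caseA (X : Submodule ℝ C(I, ℝ)) (hXcl : IsClosed (X : Set C(I, ℝ)))
    (hXlat : ∀ f ∈ X, ∀ g ∈ X, f ⊔ g ∈ X ∧ f ⊓ g ∈ X)
    (f g : C(I, ℝ)) (hf : 0 ≤ f) (hfX : f ∈ X) (hgX : g ∈ X) (t₁ t₂ : I)
    (hpos : ∀ s ∈ Set.uIcc t₁ t₂, 0 < f s) (hne : g t₁ * f t₂ ≠ g t₂ * f t₁) :
    ∃ T : C(unitInterval, ℝ) →L[ℝ] C(unitInterval, ℝ),
      (∀ f g : C(unitInterval, ℝ), T (f ⊔ g) = T f ⊔ T g) ∧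
      (∃ c : ℝ, 0 < c ∧ ∀ f : C(unitInterval, ℝ), c * ‖f‖ ≤ ‖T f‖) ∧
      LinearMap.range (T : C(unitInterval, ℝ) →ₗ[ℝ] C(unitInterval, ℝ)) ≤ X := by
  have p1 := hpos _ Set.left_mem_uIcc
  have p2 := hpos _ Set.right_mem_uIcc
  have hr : g t₂ / f t₂ - g t₁ / f t₁ ≠ 0 := by
    intro h
    rw [sub_eq_zero, div_eq_div_iff p2.ne' p1.ne'] at h
    exact hne h.symm
  let g' : C(I, ℝ) := (g t₂ / f t₂ - g t₁ / f t₁)⁻¹ • (g - (g t₁ / f t₁) • f)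
  have hg' : g' ∈ X := X.smul_mem _ (X.sub_mem hgX (X.smul_mem _ hfX))
  refine ⟨TL f g', TL_sup f g' hf, TL_below f g' t₁ t₂ hpos ?_ ?_, ?_⟩
  · simp [g', p1.ne']
  · have : g t₂ - g t₁ / f t₁ * f t₂ = (g t₂ / f t₂ - g t₁ / f t₁) * f t₂ := by
      field_simp
    simp only [g', ContinuousMap.smul_apply, ContinuousMap.sub_apply, smul_eq_mul]
    rw [this, ← mul_assoc, inv_mul_cancel₀ hr, one_mul]
  · rintro _ ⟨h, rfl⟩
    exact TL_mem X hXcl hXlat f g' hf hfX hg' h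

def rel (X : Submodule ℝ C(I, ℝ)) (s t : I) : Prop := ∃ c : ℝ, 0 < c ∧ ∀ f ∈ X, f s = c * f t

lemma rel_refl (X : Submodule ℝ C(I, ℝ)) (s : I) : rel X s s := ⟨1, one_pos, by simp⟩

lemma rel_symm {X : Submodule ℝ C(I, ℝ)} {s t : I} (h : rel X s t) : rel X t s := by
  obtain ⟨c, hc, h⟩ := h
  refine ⟨c⁻¹, by positivity, fun f hf => ?_⟩
  rw [h f hf]; field_simp

lemma rel_trans {X : Submodule ℝ C(I, ℝ)} {s t r : I} (h : rel X s t) (h' : rel X t r) :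
    rel X s r := by
  obtain ⟨c, hc, h⟩ := h
  obtain ⟨d, hd, h'⟩ := h'
  refine ⟨c * d, by positivity, fun f hf => ?_⟩
  rw [h f hf, h' f hf]; ring

def U (X : Submodule ℝ C(I, ℝ)) : Set I := {t | ∃ f ∈ X, f t ≠ 0}

structure Lat (X : Submodule ℝ C(I, ℝ)) : Prop where
  cl : IsClosed (X : Set C(I, ℝ))
  sup : ∀ f ∈ X, ∀ g ∈ X, f ⊔ g ∈ X
  inf : ∀ f ∈ X, ∀ g ∈ X, f ⊓ g ∈ X
  prop : ∀ f ∈ X, 0 ≤ f → ∀ g ∈ X, ∀ t₁ t₂ : I, (∀ s ∈ Set.uIcc t₁ t₂, 0 < f s) →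
    g t₁ * f t₂ = g t₂ * f t₁

variable {X : Submodule ℝ C(I, ℝ)}

lemma exists_norm (hX : Lat X) {g : C(I, ℝ)} (hg : g ∈ X) {t : I} (ht : g t ≠ 0) :
    ∃ f ∈ X, 0 ≤ f ∧ f t = 1 ∧ ∀ s, g s = 0 → f s = 0 := by
  refine ⟨|g t|⁻¹ • (g ⊔ -g), X.smul_mem _ (hX.sup _ hg _ (X.neg_mem hg)), ?_, ?_, ?_⟩
  · intro s
    have : 0 ≤ max (g s) (-g s) := abs_nonneg (g s)
    change 0 ≤ |g t|⁻¹ * max (g s) (-g s)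
    positivity
  · simp only [ContinuousMap.smul_apply, ContinuousMap.sup_apply,
      ContinuousMap.neg_apply, smul_eq_mul]
    exact inv_mul_cancel₀ (abs_ne_zero.mpr ht)
  · intro s hs
    simp [hs]

lemma exists_pos (hX : Lat X) {t : I} (ht : t ∈ U X) : ∃ f ∈ X, 0 ≤ f ∧ f t = 1 := by
  obtain ⟨g, hg, hgt⟩ := ht
  obtain ⟨f, h1, h2, h3, -⟩ := exists_norm hX hg hgt
  exact ⟨f, h1, h2, h3⟩

lemma rel_U {s t : I} (ht : t ∈ U X) (h : rel X s t) : s ∈ U X := by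
  obtain ⟨f, hf, hft⟩ := ht
  obtain ⟨c, hc, h⟩ := h
  exact ⟨f, hf, by rw [h f hf]; exact mul_ne_zero hc.ne' hft⟩

lemma exists_sep (hX : Lat X) {s t : I} (hs : s ∈ U X) (ht : t ∈ U X) (h : ¬ rel X s t) :
    ∃ g ∈ X, 0 ≤ g ∧ g t = 1 ∧ g s = 0 := by
  by_contra hcon
  have key : ∀ g ∈ X, g s = 0 → g t = 0 := by
    intro g hg hgs
    by_contra hgt
    obtain ⟨f, h1, h2, h3, h4⟩ := exists_norm hX hg hgt
    exact hcon ⟨f, h1, h2, h3, h4 s hgs⟩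
  obtain ⟨k, hk, hk0, hks⟩ := exists_pos hX hs
  obtain ⟨f₀, hf₀, -, hft⟩ := exists_pos hX ht
  have key2 : ∀ f ∈ X, f t = f s * k t := by
    intro f hf
    have := key (f - f s • k) (X.sub_mem hf (X.smul_mem _ hk)) (by simp [hks])
    simp only [ContinuousMap.sub_apply, ContinuousMap.smul_apply, smul_eq_mul] at this
    linarith
  have hkt : k t ≠ 0 := by
    intro h0
    have := key2 f₀ hf₀
    rw [h0, hft] at this; simp at this
  have hkt0 : 0 ≤ k t := hk0 t
  have hkt1 : 0 < k t := lt_of_le_of_ne hkt0 hkt.symm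
  refine h ⟨(k t)⁻¹, by positivity, fun f hf => ?_⟩
  rw [key2 f hf]; field_simp

def K (X : Submodule ℝ C(I, ℝ)) (t : I) : Set I := {s | rel X s t}

lemma isOpen_K (hX : Lat X) {t : I} (ht : t ∈ U X) : IsOpen (K X t) := by
  rw [isOpen_iff_mem_nhds]
  intro s hs
  obtain ⟨f, hf, hf0, hfs⟩ := exists_pos hX (rel_U ht hs)
  have hopen : {r | 0 < f r} ∈ nhds s :=
    (isOpen_lt continuous_const f.continuous).mem_nhds (by simp [hfs])
  obtain ⟨δ, hδ, hb⟩ := Metric.mem_nhds_iff.mp hopen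
  refine Filter.mem_of_superset (Metric.ball_mem_nhds s hδ) (fun r hr => ?_)
  have hpos : ∀ z ∈ Set.uIcc s r, 0 < f z := by
    intro z hz
    apply hb
    rw [Metric.mem_ball, Subtype.dist_eq, Real.dist_eq] at hr ⊢
    have hz' : (z : ℝ) ∈ Set.uIcc (s : ℝ) (r : ℝ) := by
      rw [Set.mem_uIcc] at hz ⊢
      exact hz
    exact (Set.abs_sub_left_of_mem_uIcc hz').trans_lt hr
  refine rel_trans (t := s) ⟨f r, hpos _ Set.right_mem_uIcc, fun g hg => ?_⟩ hs
  have := hX.prop f hf hf0 g hg s r hpos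
  rw [hfs] at this; linarith

open Classical in
lemma exists_atom (hX : Lat X) {t : I} (ht : t ∈ U X) :
    ∃ e ∈ X, 0 ≤ e ∧ e t = 1 ∧ ∀ s, e s ≠ 0 → rel X s t := by
  obtain ⟨f, hf, hf0, hft⟩ := exists_pos hX ht
  let e : C(I, ℝ) := ⟨fun s => if rel X s t then f s else 0, by
    rw [continuous_iff_continuousAt]
    intro s
    by_cases hs : s ∈ U X
    · have hn := (isOpen_K hX hs).mem_nhds (rel_refl X s)
      by_cases hst : rel X s t
      · refine (f.continuous.continuousAt (x := s)).congr ?_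
        filter_upwards [hn] with r hr
        rw [if_pos (rel_trans hr hst)]
      · refine (continuousAt_const (y := (0:ℝ)) (x := s)).congr ?_
        filter_upwards [hn] with r hr
        rw [if_neg (fun h => hst (rel_trans (rel_symm hr) h))]
    · have hfs : f s = 0 := by
        by_contra h
        exact hs ⟨f, hf, h⟩
      unfold ContinuousAt
      simp only [hfs, ite_self]
      have h0 : Filter.Tendsto (fun r => f r) (nhds s) (nhds 0) := by
        have := f.continuous.tendsto s
        rwa [hfs] at this
      refine squeeze_zero (fun r => ?_) (fun r => ?_) h0
      · have : 0 ≤ f r := hf0 r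
        split_ifs <;> simp [this]
      · have : 0 ≤ f r := hf0 r
        split_ifs <;> simp [this]⟩
  have he : ∀ s, e s = if rel X s t then f s else 0 := fun s => rfl
  refine ⟨e, ?_, ?_, ?_, ?_⟩
  · have : e ∈ closure (X : Set C(I, ℝ)) := by
      rw [Metric.mem_closure_iff]
      intro ε hε
      have hC : IsCompact ({s | ε ≤ f s} ∩ (K X t)ᶜ) :=
        ((isClosed_le continuous_const f.continuous).inter (isOpen_K hX ht).isClosed_compl).isCompact
      obtain ⟨g, hg, hg0, hgt, hgC⟩ := hC.induction_on
        (p := fun S => ∃ g ∈ X, 0 ≤ g ∧ g t = 1 ∧ ∀ s ∈ S, g s = 0)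
        ⟨f, hf, hf0, hft, by simp⟩
        (fun S S' hS ⟨g, h1, h2, h3, h4⟩ => ⟨g, h1, h2, h3, fun s hs => h4 s (hS hs)⟩)
        (fun S S' ⟨g, h1, h2, h3, h4⟩ ⟨g', h1', h2', h3', h4'⟩ =>
          ⟨g ⊓ g', hX.inf _ h1 _ h1', le_inf h2 h2', by simp [h3, h3'], fun s hs => by
            have a1 : 0 ≤ g s := h2 s
            have a2 : 0 ≤ g' s := h2' s
            rcases hs with hs | hs
            · simp [h4 s hs, a2]
            · simp [h4' s hs, a1]⟩)
        (by
          rintro s ⟨hs1, hs2⟩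
          have hs1' : ε ≤ f s := hs1
          have hsU : s ∈ U X := ⟨f, hf, (hε.trans_le hs1').ne'⟩
          obtain ⟨g, h1, h2, h3, h4⟩ := exists_sep hX hsU ht hs2
          refine ⟨K X s, mem_nhdsWithin_of_mem_nhds ((isOpen_K hX hsU).mem_nhds (rel_refl X s)),
            g, h1, h2, h3, ?_⟩
          rintro r ⟨c, -, hr⟩
          rw [hr g h1, h4, mul_zero])
      refine ⟨f ⊓ g, hX.inf _ hf _ hg, ?_⟩
      rw [ContinuousMap.dist_lt_iff hε]
      intro r
      have a1 : 0 ≤ f r := hf0 r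
      have a2 : 0 ≤ g r := hg0 r
      rw [he, Real.dist_eq]
      split_ifs with hr
      · obtain ⟨c, -, hr⟩ := hr
        have : (f ⊓ g) r = f r := by
          rw [hr _ (hX.inf _ hf _ hg), hr f hf]; simp [hft, hgt]
        rw [this]; simpa using hε
      · rw [ContinuousMap.inf_apply, zero_sub, abs_neg, abs_of_nonneg (le_min a1 a2)]
        by_cases hfr : ε ≤ f r
        · rw [hgC r ⟨hfr, hr⟩, min_eq_right a1]; exact hε
        · exact (min_le_left _ _).trans_lt (not_le.mp hfr)
    rwa [hX.cl.closure_eq] at this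
  · intro s
    have : 0 ≤ f s := hf0 s
    change 0 ≤ e s
    rw [he]
    split_ifs <;> simp [this]
  · rw [he, if_pos (rel_refl X t), hft]
  · intro s hs
    by_contra h
    exact hs (by rw [he, if_neg h])

/-- normalised atom: attains its max 1 at a point `p` of the class -/
lemma exists_atom' (hX : Lat X) {t : I} (ht : t ∈ U X) :
    ∃ p : I, rel X p t ∧ ∃ e ∈ X, 0 ≤ e ∧ (∀ s, e s ≤ 1) ∧ e p = 1 ∧ (∀ s, e s ≠ 0 ↔ rel X s t) ∧
      ∀ f ∈ X, ∀ s, rel X s t → f s = e s * f p := by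
  obtain ⟨e, he, he0, het, hes⟩ := exists_atom hX ht
  obtain ⟨p, -, hp⟩ := isCompact_univ.exists_isMaxOn ⟨t, Set.mem_univ _⟩ e.continuous.continuousOn
  have hpt : 1 ≤ e p := het ▸ hp (Set.mem_univ t)
  have hp0 : 0 < e p := by linarith
  have hpr : rel X p t := hes p hp0.ne'
  have hmem : (e p)⁻¹ • e ∈ X := X.smul_mem _ he
  refine ⟨p, hpr, (e p)⁻¹ • e, hmem, ?_, ?_, ?_, ?_, ?_⟩
  · intro s
    have : 0 ≤ e s := he0 s
    change 0 ≤ (e p)⁻¹ * e s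
    positivity
  · intro s
    simp only [ContinuousMap.smul_apply, smul_eq_mul]
    rw [inv_mul_le_iff₀ hp0, mul_one]
    exact hp (Set.mem_univ s)
  · simp [hp0.ne']
  · intro s
    constructor
    · intro h
      apply hes
      intro h0
      exact h (by simp [h0])
    · rintro ⟨c, hc, h⟩
      have := h e he
      simp only [ContinuousMap.smul_apply, smul_eq_mul, this, het]
      positivity
  · intro f hf s hs
    obtain ⟨c, hc, h⟩ := rel_trans hs (rel_symm hpr)
    rw [h f hf, h _ hmem]
    simp [hp0.ne']

open scoped ZeroAtInfty

lemma c0_norm_le {C : ℝ} (hC : 0 ≤ C) (f : C₀(ℕ, ℝ)) (h : ∀ n, |f n| ≤ C) : ‖f‖ ≤ C := by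
  rw [← ZeroAtInftyContinuousMap.norm_toBCF_eq_norm, BoundedContinuousFunction.norm_le hC]
  exact h

lemma c0_le_norm (f : C₀(ℕ, ℝ)) (n : ℕ) : |f n| ≤ ‖f‖ := by
  rw [← ZeroAtInftyContinuousMap.norm_toBCF_eq_norm]
  exact f.toBCF.norm_coe_le_norm n

structure Data (X : Submodule ℝ C(I, ℝ)) (p : ℕ → I) (e : ℕ → C(I, ℝ)) : Prop where
  mem : ∀ n, e n ∈ X
  nn : ∀ n s, 0 ≤ e n s
  le : ∀ n s, e n s ≤ 1
  one : ∀ n, e n (p n) = 1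
  zero : ∀ n m, n ≠ m → e n (p m) = 0
  cov : ∀ f ∈ X, ∀ s, f s ≠ 0 → ∃ n, e n s ≠ 0
  eq : ∀ f ∈ X, ∀ s n, e n s ≠ 0 → f s = e n s * f (p n)

variable {p : ℕ → I} {e : ℕ → C(I, ℝ)}

lemma tendsto_zero (hD : Data X p e) {f : C(I, ℝ)} (hf : f ∈ X) :
    Filter.Tendsto (fun n => f (p n)) (Filter.cocompact ℕ) (nhds 0) := by
  rw [Metric.tendsto_nhds]
  intro ε hε
  rw [Filter.cocompact_eq_cofinite, Filter.eventually_cofinite]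
  have hC : IsCompact {s | ε ≤ |f s|} :=
    (isClosed_le continuous_const f.continuous.abs).isCompact
  obtain ⟨F, hF⟩ := hC.elim_finite_subcover (fun n => {s | e n s ≠ 0})
    (fun n => isOpen_ne_fun (e n).continuous continuous_const) (by
      intro s hs
      have hs' : ε ≤ |f s| := hs
      obtain ⟨n, hn⟩ := hD.cov f hf s (abs_pos.mp (hε.trans_le hs'))
      exact Set.mem_iUnion.mpr ⟨n, hn⟩)
  refine F.finite_toSet.subset (fun n hn => ?_)
  have hn' : p n ∈ {s | ε ≤ |f s|} := by
    simpa [Real.dist_eq] using hn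
  have := hF hn'
  simp only [Set.mem_iUnion] at this
  obtain ⟨m, hm, hmn⟩ := this
  by_cases h : m = n
  · rw [← h]; exact hm
  · exact absurd (hD.zero m n h) hmn

lemma norm_bound (hD : Data X p e) {f : C(I, ℝ)} (hf : f ∈ X) {C : ℝ} (hC : 0 ≤ C)
    (h : ∀ n, |f (p n)| ≤ C) : ‖f‖ ≤ C := by
  rw [ContinuousMap.norm_le _ hC]
  intro s
  by_cases hs : f s = 0
  · rw [hs]; simpa using hC
  · obtain ⟨n, hn⟩ := hD.cov f hf s hs
    rw [hD.eq f hf s n hn, Real.norm_eq_abs, abs_mul, abs_of_nonneg (hD.nn n s)]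
    have := hD.le n s
    have := hD.nn n s
    have := h n
    nlinarith [abs_nonneg (f (p n))]

noncomputable def S (hD : Data X p e) : X →ₗᵢ[ℝ] C₀(ℕ, ℝ) where
  toFun f := ⟨⟨fun n => f.1 (p n), continuous_of_discreteTopology⟩, tendsto_zero hD f.2⟩
  map_add' f g := rfl
  map_smul' c f := rfl
  norm_map' f := by
    apply le_antisymm
    · refine c0_norm_le (norm_nonneg _) _ (fun n => ?_)
      exact f.1.norm_coe_le_norm (p n)
    · exact norm_bound hD f.2 (norm_nonneg _) (fun n => c0_le_norm
        ⟨⟨fun n => f.1 (p n), continuous_of_discreteTopology⟩, tendsto_zero hD f.2⟩ n)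

lemma S_apply (hD : Data X p e) (f : X) (n : ℕ) : S hD f n = f.1 (p n) := rfl

lemma S_surj (hX : IsClosed (X : Set C(I, ℝ))) (hD : Data X p e) :
    Function.Surjective (S hD) := by
  have : CompleteSpace X := hX.completeSpace_coe
  have hcl : IsClosed (Set.range (S hD)) := (S hD).isometry.isClosedEmbedding.isClosed_range
  intro a
  have : a ∈ closure (Set.range (S hD)) := by
    rw [Metric.mem_closure_iff]
    intro ε hε
    have ha := a.zero_at_infty'
    rw [Metric.tendsto_nhds] at ha
    have ha := ha (ε / 2) (by positivity)
    rw [Filter.cocompact_eq_cofinite, Filter.eventually_cofinite] at ha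
    let F := ha.toFinset
    refine ⟨S hD (∑ n ∈ F, a n • ⟨e n, hD.mem n⟩), ⟨_, rfl⟩, ?_⟩
    rw [dist_eq_norm]
    refine lt_of_le_of_lt (c0_norm_le (C := ε / 2) (by positivity) _ (fun m => ?_)) (by linarith)
    have hval : S hD (∑ n ∈ F, a n • ⟨e n, hD.mem n⟩) m = if m ∈ F then a m else 0 := by
      rw [S_apply]
      have : ((∑ n ∈ F, a n • (⟨e n, hD.mem n⟩ : X) : X) : C(I, ℝ)) (p m)
          = ∑ n ∈ F, a n * e n (p m) := by
        simp [ContinuousMap.sum_apply]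
      rw [this]
      have h2 : ∀ n ∈ F, a n * e n (p m) = if n = m then a m else 0 := by
        intro n _
        split_ifs with h
        · rw [h, hD.one, mul_one]
        · rw [hD.zero n m h, mul_zero]
      rw [Finset.sum_congr rfl h2, Finset.sum_ite_eq']
    rw [ZeroAtInftyContinuousMap.sub_apply, hval]
    split_ifs with h
    · simp; positivity
    · have h3 : m ∉ {x | ¬dist (a.toFun x) 0 < ε / 2} := by simpa [F] using h
      simp only [Set.mem_ofPred_eq, not_not] at h3
      rw [Real.dist_eq] at h3
      exact le_of_lt (by simpa using h3)
  rw [hcl.closure_eq] at this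
  exact this

lemma iso_of_data (hX : Lat X) (hD : Data X p e) : LatticeIsoToCzero X := by
  let E := LinearIsometryEquiv.ofSurjective (S hD) (S_surj hX.cl hD)
  have hE : ∀ a n, (E.symm a).1 (p n) = a n := by
    intro a n
    rw [← S_apply hD]
    have : S hD (E.symm a) = a := E.apply_symm_apply a
    rw [this]
  refine ⟨X.subtypeL.comp (E.symm.toContinuousLinearEquiv : C₀(ℕ, ℝ) →L[ℝ] X), ?_,
    ⟨1, one_pos, ?_⟩, ?_⟩
  · ext f
    constructor
    · rintro ⟨a, rfl⟩
      exact (E.symm a).2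
    · intro hf
      refine ⟨E ⟨f, hf⟩, ?_⟩
      have : E.symm (E ⟨f, hf⟩) = ⟨f, hf⟩ := E.symm_apply_apply _
      exact congrArg Subtype.val this
  · intro a
    rw [one_mul]
    exact (E.symm.norm_map a).ge
  · intro f g h hfg
    change (E.symm h).1 = (E.symm f).1 ⊔ (E.symm g).1
    have hm : (E.symm f).1 ⊔ (E.symm g).1 ∈ X := hX.sup _ (E.symm f).2 _ (E.symm g).2
    have : E.symm h = ⟨_, hm⟩ := by
      apply (S hD).injective
      ext n
      change (E.symm h).1 (p n) = max ((E.symm f).1 (p n)) ((E.symm g).1 (p n))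
      rw [hE, hE, hE, hfg]
    exact congrArg Subtype.val this

def st (X : Submodule ℝ C(I, ℝ)) : Setoid (U X) where
  r a b := rel X a.1 b.1
  iseqv := ⟨fun a => rel_refl X a.1, rel_symm, rel_trans⟩

lemma exists_data (hX : Lat X) (hinf : ¬ FiniteDimensional ℝ X) : ∃ p e, Data X p e := by
  let Q := Quotient (st X)
  let r : Q → I := fun q => q.out.1
  have hrU : ∀ q, r q ∈ U X := fun q => q.out.2
  have hrel : ∀ s ∈ U X, ∃ q, rel X s (r q) := by
    intro s hs
    refine ⟨Quotient.mk (st X) ⟨s, hs⟩, ?_⟩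
    exact rel_symm (Quotient.mk_out (s := st X) (⟨s, hs⟩ : U X))
  have hinj : ∀ q q', rel X (r q) (r q') → q = q' := by
    intro q q' h
    exact Quotient.out_equiv_out.mp h
  choose p hp e heX he0 he1 hep hes hef using fun q => exists_atom' hX (hrU q)
  have hcount : Countable Q := by
    have : (Set.univ : Set Q).Countable := by
      refine Set.PairwiseDisjoint.countable_of_isOpen (s := fun q => K X (r q)) ?_
        (fun q _ => isOpen_K hX (hrU q)) (fun q _ => ⟨r q, rel_refl X _⟩)
      intro q _ q' _ hqq
      refine Set.disjoint_left.mpr (fun s hs hs' => hqq (hinj _ _ ?_))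
      exact rel_trans (rel_symm hs) hs'
    exact Set.countable_univ_iff.mp this
  have hinfQ : Infinite Q := by
    by_contra hfin
    rw [not_infinite_iff_finite] at hfin
    apply hinf
    let φ : X →ₗ[ℝ] (Q → ℝ) :=
      { toFun := fun f q => f.1 (p q)
        map_add' := fun f g => rfl
        map_smul' := fun c g => rfl }
    refine FiniteDimensional.of_injective φ ?_
    rw [injective_iff_map_eq_zero]
    intro f hf
    apply Subtype.ext
    ext s
    by_contra hs
    obtain ⟨q, hq⟩ := hrel s ⟨f.1, f.2, hs⟩
    have h1 := hef q f.1 f.2 s hq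
    have h2 : f.1 (p q) = 0 := congrFun hf q
    rw [h2, mul_zero] at h1
    exact hs h1
  obtain ⟨d⟩ := nonempty_denumerable Q
  let E : Q ≃ ℕ := Denumerable.eqv Q
  refine ⟨fun n => p (E.symm n), fun n => e (E.symm n), ⟨fun n => heX _, fun n s => he0 _ s,
    fun n s => he1 _ s, fun n => hep _, ?_, ?_, ?_⟩⟩
  · intro n m hnm
    by_contra h
    apply hnm
    apply E.symm.injective
    apply hinj
    exact rel_symm (rel_trans (rel_symm (hp _)) ((hes _ _).mp h))
  · intro f hf s hs
    obtain ⟨q, hq⟩ := hrel s ⟨f, hf, hs⟩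
    refine ⟨E q, ?_⟩
    rw [E.symm_apply_apply]
    exact (hes _ _).mpr hq
  · intro f hf s n hn
    exact hef _ f hf s ((hes _ _).mp hn)

end SubDich

/-- Every infinite-dimensional closed sublattice of `C[0,1]` is either lattice
isomorphic to `c₀` or contains a closed sublattice lattice isomorphic to `C[0,1]`
(i.e. `C[0,1]` lattice embeds into it). -/
theorem sublattice_dichotomy
    (X : Submodule ℝ C(unitInterval, ℝ))
    (hXcl : IsClosed (X : Set C(unitInterval, ℝ)))
    (hXlat : ∀ f ∈ X, ∀ g ∈ X, f ⊔ g ∈ X ∧ f ⊓ g ∈ X)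
    (hXinf : ¬ FiniteDimensional ℝ X) :
    LatticeIsoToCzero X ∨
    ∃ T : C(unitInterval, ℝ) →L[ℝ] C(unitInterval, ℝ),
      (∀ f g : C(unitInterval, ℝ), T (f ⊔ g) = T f ⊔ T g) ∧
      (∃ c : ℝ, 0 < c ∧ ∀ f : C(unitInterval, ℝ), c * ‖f‖ ≤ ‖T f‖) ∧
      LinearMap.range (T : C(unitInterval, ℝ) →ₗ[ℝ] C(unitInterval, ℝ)) ≤ X := by
  by_cases hB : ∀ f ∈ X, 0 ≤ f → ∀ g ∈ X, ∀ t₁ t₂ : unitInterval,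
      (∀ s ∈ Set.uIcc t₁ t₂, 0 < f s) → g t₁ * f t₂ = g t₂ * f t₁
  · left
    have hX : SubDich.Lat X := ⟨hXcl, fun f hf g hg => (hXlat f hf g hg).1,
      fun f hf g hg => (hXlat f hf g hg).2, hB⟩
    obtain ⟨p, e, hD⟩ := SubDich.exists_data hX hXinf
    exact SubDich.iso_of_data hX hD
  · right
    push Not at hB
    obtain ⟨f, hf, hf0, g, hg, t₁, t₂, hpos, hne⟩ := hB
    exact SubDich.caseA X hXcl hXlat f g hf0 hf hg t₁ t₂ hpos hne
end
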